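/- Let B be the bilinear form on (ℤ/5ℤ)² given by B(x,y) = xᵀ J y where J has rows (0, 1) and (−1, 0), with symplectic quandle operation x ▷ y = x + B(x,y)·y. Among the quadruples (l, m₁, m₂, r) ∈ ((ℤ/5ℤ)²)⁴ satisfying l = l ▷ m₁, m₂ = m₁ ▷ l, m₁ = m₂ ▷ r, r = r ▷ m₂, exactly 25 have image {l, m₁, m₂, r} of cardinality 1, exactly 360 have image of cardinality 2, exactly 840 have image of cardinality 3, and none has image of cardinality greater than 3 (i.e. the enhanced quandle counting polynomial of H over this quandle is 25q + 360q² + 840q³). -/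

import Mathlib

open Matrix

/-- The bilinear form `B(x,y) = xᵀ J' y` on `(ℤ/5ℤ)²`, where `J' = !![0, 1; -1, 0]`. -/
def B5 (x y : Fin 2 → ZMod 5) : ZMod 5 :=
  x ⬝ᵥ ((!![0, 1; -1, 0] : Matrix (Fin 2) (Fin 2) (ZMod 5)).mulVec y)

/-- The symplectic quandle operation `x ▷ y = x + B(x,y) • y` on `(ℤ/5ℤ)²`. -/
def op5 (x y : Fin 2 → ZMod 5) : Fin 2 → ZMod 5 :=
  x + B5 x y • y

/-- The four crossing relations of the connected sum of two Hopf links for the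
quadruple of arc colors `(l, m₁, m₂, r)`. -/
def rel5 (c : (Fin 2 → ZMod 5) × (Fin 2 → ZMod 5) × (Fin 2 → ZMod 5) × (Fin 2 → ZMod 5)) :
    Prop :=
  c.1 = op5 c.1 c.2.1 ∧ c.2.2.1 = op5 c.2.1 c.1 ∧
    c.2.1 = op5 c.2.2.1 c.2.2.2 ∧ c.2.2.2 = op5 c.2.2.2 c.2.2.1

instance : DecidablePred rel5 := fun c => by unfold rel5; infer_instance

/-- The image of a coloring: the set of colors `{l, m₁, m₂, r}` used on the arcs. -/
def img5 (c : (Fin 2 → ZMod 5) × (Fin 2 → ZMod 5) × (Fin 2 → ZMod 5) × (Fin 2 → ZMod 5)) :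
    Finset (Fin 2 → ZMod 5) :=
  {c.1, c.2.1, c.2.2.1, c.2.2.2}

theorem B5_apply (x y : Fin 2 → ZMod 5) : B5 x y = x 0 * y 1 - x 1 * y 0 := by
  simp [B5, dotProduct, mulVec, Fin.sum_univ_two]
  ring

theorem B5_swap (x y : Fin 2 → ZMod 5) : B5 y x = -B5 x y := by
  rw [B5_apply, B5_apply]
  ring

theorem eq_op5_iff (x y : Fin 2 → ZMod 5) : x = op5 x y ↔ B5 x y = 0 := by
  have : Fact (Nat.Prime 5) := ⟨by norm_num⟩
  rw [op5, left_eq_add, smul_eq_zero, or_iff_left_of_imp]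
  rintro rfl
  simp [B5_apply]

theorem rel5_iff (l m n r : Fin 2 → ZMod 5) :
    rel5 (l, m, n, r) ↔ n = m ∧ B5 l m = 0 ∧ B5 r m = 0 := by
  simp only [rel5, eq_op5_iff]
  constructor
  · rintro ⟨hl, hn, -, hr⟩
    have hnm : n = m := by simpa [op5, B5_swap l m, hl] using hn
    exact ⟨hnm, hl, hnm ▸ hr⟩
  · rintro ⟨rfl, hl, hr⟩
    exact ⟨hl, (eq_op5_iff _ _).2 (by rw [B5_swap, hl, neg_zero]),
      (eq_op5_iff _ _).2 (by rw [B5_swap, hr, neg_zero]), hr⟩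

/-- The vectors `B5`-orthogonal to `m`. -/
def orth5 (m : Fin 2 → ZMod 5) : Finset (Fin 2 → ZMod 5) :=
  Finset.univ.filter (fun x => B5 x m = 0)

theorem mem_orth5 {x m : Fin 2 → ZMod 5} : x ∈ orth5 m ↔ B5 x m = 0 := by
  simp [orth5]

theorem self_mem_orth5 (m : Fin 2 → ZMod 5) : m ∈ orth5 m := by
  rw [mem_orth5, B5_apply]
  ring

theorem card_orth5_zero : (orth5 0).card = 25 := by
  simp [orth5, B5_apply]

theorem card_orth5_of_ne_zero : ∀ m : Fin 2 → ZMod 5, m ≠ 0 → (orth5 m).card = 5 := by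
  decide +kernel

/-- A sum over all `m` of a function of the number of vectors orthogonal to `m`. -/
theorem sum_card_orth5 (g : ℕ → ℕ) : ∑ m, g (orth5 m).card = g 25 + 24 * g 5 := by
  rw [Fintype.sum_eq_add_sum_compl 0, card_orth5_zero,
    Finset.sum_congr rfl (g := fun _ => g 5)
      (fun m hm => by rw [card_orth5_of_ne_zero m (by simpa using hm)])]
  simp [Finset.card_compl]

/-- The colorings with image of size `k`, counted by the color of the middle component. -/
theorem card_coloring (k : ℕ) :
    (Finset.univ.filter (fun c => rel5 c ∧ (img5 c).card = k)).card =
      ∑ m, ((orth5 m ×ˢ orth5 m).filter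
        (fun p => ({p.1, m, p.2} : Finset (Fin 2 → ZMod 5)).card = k)).card := by
  rw [Finset.card_eq_sum_card_fiberwise (f := fun c => c.2.1) (t := Finset.univ) (by simp)]
  refine Finset.sum_congr rfl fun m _ => ?_
  refine Finset.card_nbij' (fun c => (c.1, c.2.2.2)) (fun p => (p.1, m, m, p.2)) ?_ ?_ ?_ ?_
  · rintro ⟨l, m', n, r⟩ h
    simp only [Finset.coe_filter, Finset.mem_filter, Finset.mem_univ, true_and, rel5_iff,
      Set.mem_ofPred_eq] at h
    obtain ⟨⟨⟨rfl, hl, hr⟩, hk⟩, rfl⟩ := h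
    simpa [mem_orth5, hl, hr, img5] using hk
  · rintro ⟨l, r⟩ h
    simp only [Finset.coe_filter, Finset.mem_product, mem_orth5, Set.mem_ofPred_eq] at h
    refine Finset.mem_coe.2 (Finset.mem_filter.2 ⟨Finset.mem_filter.2
      ⟨Finset.mem_univ _, (rel5_iff _ _ _ _).2 ⟨rfl, h.1⟩, ?_⟩, rfl⟩)
    simpa [img5] using h.2
  · rintro ⟨l, m', n, r⟩ h
    simp only [Finset.coe_filter, Finset.mem_filter, Finset.mem_univ, true_and, rel5_iff,
      Set.mem_ofPred_eq] at h
    obtain ⟨⟨⟨rfl, -, -⟩, -⟩, rfl⟩ := h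
    rfl
  · rintro ⟨l, r⟩ _
    rfl

section Triples

variable {α : Type*} [DecidableEq α]

theorem card_triple_eq_one_iff {a b c : α} :
    ({a, b, c} : Finset α).card = 1 ↔ a = b ∧ c = b := by
  by_cases hab : a = b <;> by_cases hbc : b = c <;> by_cases hac : a = c <;>
    simp_all [Finset.card_insert_of_notMem, eq_comm]

theorem card_triple_eq_three_iff {a b c : α} :
    ({a, b, c} : Finset α).card = 3 ↔ a ≠ b ∧ c ≠ b ∧ a ≠ c := by
  by_cases hab : a = b <;> by_cases hbc : b = c <;> by_cases hac : a = c <;>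
    simp_all [Finset.card_insert_of_notMem, eq_comm]

theorem card_filter_triple_eq_one {s : Finset α} {m : α} (hm : m ∈ s) :
    ((s ×ˢ s).filter (fun p => ({p.1, m, p.2} : Finset α).card = 1)).card = 1 := by
  rw [Finset.card_eq_one]
  refine ⟨(m, m), ?_⟩
  ext ⟨a, c⟩
  simp only [Finset.mem_filter, Finset.mem_product, card_triple_eq_one_iff,
    Finset.mem_singleton, Prod.mk.injEq]
  constructor
  · exact And.right
  · rintro ⟨rfl, rfl⟩
    exact ⟨⟨hm, hm⟩, rfl, rfl⟩

theorem card_filter_triple_eq_three {s : Finset α} {m : α} (hm : m ∈ s) :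
    ((s ×ˢ s).filter (fun p => ({p.1, m, p.2} : Finset α).card = 3)).card =
      (s.card - 1) * (s.card - 1) - (s.card - 1) := by
  rw [← Finset.card_erase_of_mem hm, ← Finset.offDiag_card]
  congr 1
  ext ⟨a, c⟩
  simp only [Finset.mem_filter, Finset.mem_product, card_triple_eq_three_iff,
    Finset.mem_offDiag, Finset.mem_erase]
  tauto

theorem card_filter_triple_add (s : Finset α) (m : α) :
    ((s ×ˢ s).filter (fun p => ({p.1, m, p.2} : Finset α).card = 1)).card +
      ((s ×ˢ s).filter (fun p => ({p.1, m, p.2} : Finset α).card = 2)).card +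
      ((s ×ˢ s).filter (fun p => ({p.1, m, p.2} : Finset α).card = 3)).card =
      s.card * s.card := by
  rw [← Finset.card_product, Finset.card_eq_sum_card_fiberwise (s := s ×ˢ s)
    (f := fun p : α × α => ({p.1, m, p.2} : Finset α).card) (t := {1, 2, 3})]
  · simp [add_assoc]
  · rintro ⟨a, c⟩ _
    have hle : ({a, m, c} : Finset α).card ≤ 3 := Finset.card_le_three
    have hpos : 0 < ({a, m, c} : Finset α).card := Finset.card_pos.2 ⟨a, by simp⟩
    simp only [Finset.coe_insert, Finset.coe_singleton, Set.mem_insert_iff,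
      Set.mem_singleton_iff]
    omega

end Triples

/-- the enhanced quandle counting polynomial of the connected sum of
two Hopf links over the symplectic quandle on `(ℤ/5ℤ)²` with form `J`
is `25q + 360q² + 840q³`: 25 colorings of image size 1, 360 of image size 2, 840 of image
size 3, and none of image size greater than 3. -/
theorem hopf_connected_sum_enhanced_Z5 :
    (Finset.univ.filter (fun c => rel5 c ∧ (img5 c).card = 1)).card = 25 ∧
    (Finset.univ.filter (fun c => rel5 c ∧ (img5 c).card = 2)).card = 360 ∧
    (Finset.univ.filter (fun c => rel5 c ∧ (img5 c).card = 3)).card = 840 ∧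
    (∀ c, rel5 c → (img5 c).card ≤ 3) := by
  have h₁ := card_coloring 1
  have h₂ := card_coloring 2
  have h₃ := card_coloring 3
  simp only [card_filter_triple_eq_one (self_mem_orth5 _)] at h₁
  simp only [card_filter_triple_eq_three (self_mem_orth5 _),
    sum_card_orth5 (fun n => (n - 1) * (n - 1) - (n - 1))] at h₃
  have htotal := Finset.sum_congr (rfl : (Finset.univ : Finset (Fin 2 → ZMod 5)) = _)
    fun m _ => card_filter_triple_add (orth5 m) m
  simp only [Finset.sum_add_distrib, card_filter_triple_eq_one (self_mem_orth5 _),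
    card_filter_triple_eq_three (self_mem_orth5 _),
    sum_card_orth5 (fun n => (n - 1) * (n - 1) - (n - 1)),
    sum_card_orth5 (fun n => n * n), ← h₂] at htotal
  have hone : ∑ _m : Fin 2 → ZMod 5, 1 = 25 := by simp
  rw [hone] at h₁ htotal
  refine ⟨h₁, ?_, h₃, ?_⟩
  · generalize (Finset.univ.filter (fun c => rel5 c ∧ (img5 c).card = 2)).card = n at htotal ⊢
    omega
  rintro ⟨l, m, n, r⟩ h
  obtain ⟨rfl, -, -⟩ := (rel5_iff _ _ _ _).1 h
  simpa [img5] using (Finset.card_le_three : ({l, n, r} : Finset (Fin 2 → ZMod 5)).card ≤ 3)
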